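/- For all integers m ≥ 3 and n ≥ 2, the Cartesian product C_m □ P_n of a cycle and a path satisfies tndi(C_m □ P_n) = Δ + 2, where Δ is the maximum degree of C_m □ P_n (so Δ = 3 if n = 2 and Δ = 4 if n ≥ 3). -/

import Mathlib

open Finset SimpleGraph

/-- A neighbor-sum-distinguishing proper total `k`-coloring of `G`:
vertex colors `cv` and edge colors `ce` taken from `{1, …, k}`, proper on
vertices, edges, and incidences, and distinguishing adjacent vertices by the
total sum of colors at each vertex. -/
def IsProperTotalColoring {V : Type*} [Fintype V] (G : SimpleGraph V) (k : ℕ)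
    (cv : V → ℕ) (ce : Sym2 V → ℕ) : Prop :=
  (∀ v, cv v ∈ Finset.Icc 1 k) ∧
  (∀ u v, G.Adj u v → ce s(u, v) ∈ Finset.Icc 1 k) ∧
  (∀ u v, G.Adj u v → cv u ≠ cv v) ∧
  (∀ u v w, G.Adj u v → G.Adj u w → v ≠ w → ce s(u, v) ≠ ce s(u, w)) ∧
  (∀ u v, G.Adj u v → ce s(u, v) ≠ cv u ∧ ce s(u, v) ≠ cv v)

open Classical in
/-- The total color-sum at a vertex: the color of `v` plus the colors of all
edges incident with `v`. -/
noncomputable def totalSum {V : Type*} [Fintype V] (G : SimpleGraph V)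
    (cv : V → ℕ) (ce : Sym2 V → ℕ) (v : V) : ℕ :=
  cv v + ∑ w ∈ Finset.univ.filter (fun w => G.Adj v w), ce s(v, w)

/-- A neighbor-sum-distinguishing proper total `k`-coloring. -/
def IsNSDColoring {V : Type*} [Fintype V] (G : SimpleGraph V) (k : ℕ)
    (cv : V → ℕ) (ce : Sym2 V → ℕ) : Prop :=
  IsProperTotalColoring G k cv ce ∧
  ∀ u v, G.Adj u v → totalSum G cv ce u ≠ totalSum G cv ce v

/-- `tndi G` is the least `k` such that `G` admits a neighbor-sum-distinguishing
proper total `k`-coloring. -/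
noncomputable def tndi {V : Type*} [Fintype V] (G : SimpleGraph V) : ℕ :=
  sInf {k | ∃ cv ce, IsNSDColoring G k cv ce}

/-- The maximum degree of a finite simple graph. -/
noncomputable def maxDeg {V : Type*} [Fintype V] (G : SimpleGraph V) : ℕ :=
  @SimpleGraph.maxDegree V G _ (Classical.decRel _)

/-- The star `S_n = K_{1,n}` with center `0` and `n` leaves. -/
def starGraph (n : ℕ) : SimpleGraph (Fin (n + 1)) :=
  SimpleGraph.fromRel fun i _ => i = 0

/-- The wheel `W_m`: hub `0` joined to every vertex of the cycle on `1, …, m`. -/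
def wheelGraph (m : ℕ) : SimpleGraph (Fin (m + 1)) :=
  SimpleGraph.fromRel fun i j =>
    i = 0 ∨ (j.val = i.val + 1 ∧ 2 ≤ j.val) ∨ (i.val = m ∧ j.val = 1)

lemma cycleGraph_adj_iff_succ {k : ℕ} {a b : Fin (k + 3)} :
    (cycleGraph (k + 3)).Adj a b ↔ b = a + 1 ∨ b = a - 1 := by
  rw [cycleGraph_adj, or_comm, sub_eq_iff_eq_add', sub_eq_iff_eq_add', eq_sub_iff_add_eq,
    eq_comm (a := a)]

lemma Fin.sub_one_ne_add_one {k : ℕ} (a : Fin (k + 3)) : a - 1 ≠ a + 1 := by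
  simp only [ne_eq, sub_eq_iff_eq_add, add_assoc a, left_eq_add]
  exact ne_of_beq_false rfl

lemma sum_pathGraph_neighborFinset {n : ℕ} (g : ℕ → ℕ) (j : Fin n)
    [Fintype ((pathGraph n).neighborSet j)] :
    ∑ b ∈ (pathGraph n).neighborFinset j, g b =
      (if j.val + 1 < n then g (j + 1) else 0) + (if 0 < j.val then g (j - 1) else 0) := by
  classical
  have h : (pathGraph n).neighborFinset j =
      ({b | j.val + 1 = b.val} : Finset (Fin n)) ∪
        ({b | b.val = j.val - 1 ∧ 0 < j.val} : Finset (Fin n)) := by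
    ext b
    simp only [mem_neighborFinset, pathGraph_adj, mem_union, mem_filter, mem_univ, true_and]
    omega
  rw [h, sum_union, sum_filter, sum_filter,
    Fin.sum_univ_eq_sum_range (fun b => if j.val + 1 = b then g b else 0),
    Fin.sum_univ_eq_sum_range (fun b => if b = j.val - 1 ∧ 0 < j.val then g b else 0)]
  · simp only [sum_ite_eq, mem_range, ite_and, sum_ite_eq']
    congr 1
    have := j.isLt
    rw [if_pos (by omega)]
  · rw [disjoint_filter]
    intro b _ h1 h2
    omega

/-- The sum of a function over the neighbors of a vertex of `C_m □ P_n`. -/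
lemma sum_cycle_boxProd_path {k n : ℕ} (g : Fin (k + 3) × Fin n → ℕ) (i : Fin (k + 3)) (j : Fin n)
    (r : ℕ → ℕ) (hr : ∀ b : Fin n, r b = g (i, b))
    [Fintype (((cycleGraph (k + 3)).boxProd (pathGraph n)).neighborSet (i, j))] :
    ∑ w ∈ ((cycleGraph (k + 3)).boxProd (pathGraph n)).neighborFinset (i, j), g w =
      g (i + 1, j) + g (i - 1, j) + (if j.val + 1 < n then r (j + 1) else 0) +
        (if 0 < j.val then r (j - 1) else 0) := by
  classical
  rw [neighborFinset_boxProd, sum_disjUnion, sum_product, sum_product, sum_singleton,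
    cycleGraph_neighborFinset, sum_pair (Fin.sub_one_ne_add_one i), sum_singleton, sum_singleton,
    add_assoc _ (ite _ _ _), ← sum_pathGraph_neighborFinset r, add_comm (g (i - 1, j))]
  simp only [hr]

lemma degree_cycle_boxProd_path {k n : ℕ} (i : Fin (k + 3)) (j : Fin n)
    [Fintype (((cycleGraph (k + 3)).boxProd (pathGraph n)).neighborSet (i, j))] :
    ((cycleGraph (k + 3)).boxProd (pathGraph n)).degree (i, j) =
      2 + (if j.val + 1 < n then 1 else 0) + (if 0 < j.val then 1 else 0) := by
  rw [← card_neighborFinset_eq_degree, card_eq_sum_ones]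
  exact sum_cycle_boxProd_path (fun _ => 1) i j (fun _ => 1) fun _ => rfl

lemma maxDeg_cycle_boxProd_path {k n : ℕ} (hn : 2 ≤ n) :
    maxDeg ((cycleGraph (k + 3)).boxProd (pathGraph n)) = if n = 2 then 3 else 4 := by
  classical
  unfold maxDeg
  apply le_antisymm
  · apply maxDegree_le_of_forall_degree_le
    rintro ⟨i, j⟩
    rw [degree_cycle_boxProd_path]
    split_ifs <;> omega
  · refine le_trans ?_ (degree_le_maxDegree _ ((0 : Fin (k + 3)), (⟨1, by omega⟩ : Fin n)))
    rw [degree_cycle_boxProd_path]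
    split_ifs <;> grind

/-- If at most `deg v + 1` colors are available, then all of them appear around `v`. -/
lemma IsProperTotalColoring.totalSum_eq {V : Type*} [Fintype V] {G : SimpleGraph V} {k : ℕ}
    {cv : V → ℕ} {ce : Sym2 V → ℕ} (h : IsProperTotalColoring G k cv ce) (v : V)
    [Fintype (G.neighborSet v)] (hk : k ≤ G.degree v + 1) :
    totalSum G cv ce v = ∑ x ∈ Icc 1 k, x := by
  classical
  obtain ⟨h1, h2, -, h4, h5⟩ := h
  have hN : univ.filter (fun w => G.Adj v w) = G.neighborFinset v := by ext; simp
  have hinj : Set.InjOn (fun w => ce s(v, w)) (G.neighborFinset v) := by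
    intro a ha b hb hab
    by_contra hne
    exact h4 v a b (by simpa using ha) (by simpa using hb) hne hab
  have hnot : cv v ∉ (G.neighborFinset v).image (fun w => ce s(v, w)) := by
    simp only [mem_image, mem_neighborFinset, not_exists, not_and]
    exact fun w hw => (h5 v w hw).1
  have hsub : insert (cv v) ((G.neighborFinset v).image (fun w => ce s(v, w))) ⊆ Icc 1 k := by
    intro x hx
    rw [mem_insert, mem_image] at hx
    rcases hx with rfl | ⟨w, hw, rfl⟩
    · exact h1 v
    · exact h2 v w (by simpa using hw)
  have heq := eq_of_subset_of_card_le hsub (by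
    rw [card_insert_of_notMem hnot, card_image_of_injOn hinj, card_neighborFinset_eq_degree,
      Nat.card_Icc]
    omega)
  rw [← heq, sum_insert hnot, sum_image hinj, totalSum]
  congr!

lemma le_of_isNSDColoring {k n K : ℕ} (hn : 2 ≤ n) {cv : Fin (k + 3) × Fin n → ℕ}
    {ce : Sym2 (Fin (k + 3) × Fin n) → ℕ}
    (h : IsNSDColoring ((cycleGraph (k + 3)).boxProd (pathGraph n)) K cv ce) :
    maxDeg ((cycleGraph (k + 3)).boxProd (pathGraph n)) + 2 ≤ K := by
  classical
  rw [maxDeg_cycle_boxProd_path hn]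
  by_contra! hK
  have key (i : Fin (k + 3)) := h.1.totalSum_eq (i, (⟨1, hn⟩ : Fin n)) (by
    rw [degree_cycle_boxProd_path]
    grind)
  exact h.2 (0, ⟨1, hn⟩) (0 + 1, ⟨1, hn⟩)
    (boxProd_adj_left.2 (cycleGraph_adj_iff_succ.2 (Or.inl rfl))) ((key _).trans (key _).symm)

/-- The total color-sum at the vertex `(i, j)` of `C_m □ P_n` when `c i j`, `h i j` and `v i j` are
the colors of `(i, j)`, of the edge to `(i + 1, j)` and of the edge to `(i, j + 1)`. -/
def gridSum {k : ℕ} (n : ℕ) (c h v : Fin (k + 3) → ℕ → ℕ) (i : Fin (k + 3)) (j : ℕ) : ℕ :=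
  c i j + (h i j + h (i - 1) j + (if j + 1 < n then v i j else 0) +
    (if 0 < j then v i (j - 1) else 0))

/-- The functions `c`, `h`, `v` describe a neighbor-sum-distinguishing proper total `K`-coloring
of `C_m □ P_n` in the sense of `gridSum`. -/
structure IsGridColoring {k : ℕ} (n K : ℕ) (c h v : Fin (k + 3) → ℕ → ℕ) : Prop where
  c_mem : ∀ i j, j < n → c i j ∈ Icc 1 K
  h_mem : ∀ i j, j < n → h i j ∈ Icc 1 K
  v_mem : ∀ i j, j + 1 < n → v i j ∈ Icc 1 K
  c_ne_right : ∀ i j, j < n → c i j ≠ c (i + 1) j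
  c_ne_up : ∀ i j, j + 1 < n → c i j ≠ c i (j + 1)
  h_ne_c : ∀ i j, j < n → h i j ≠ c i j ∧ h i j ≠ c (i + 1) j
  v_ne_c : ∀ i j, j + 1 < n → v i j ≠ c i j ∧ v i j ≠ c i (j + 1)
  h_ne_h : ∀ i j, j < n → h i j ≠ h (i - 1) j
  v_ne_h : ∀ i j, j + 1 < n → v i j ≠ h i j ∧ v i j ≠ h (i - 1) j
  v_ne_h_up : ∀ i j, j + 1 < n → v i j ≠ h i (j + 1) ∧ v i j ≠ h (i - 1) (j + 1)
  v_ne_v : ∀ i j, j + 2 < n → v i j ≠ v i (j + 1)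
  sum_ne_right : ∀ i j, j < n → gridSum n c h v i j ≠ gridSum n c h v (i + 1) j
  sum_ne_up : ∀ i j, j + 1 < n → gridSum n c h v i j ≠ gridSum n c h v i (j + 1)

/-- The edge coloring of `C_m □ P_n` with colors `h` on cycle edges and `v` on path edges. -/
def gridEdgeColor {k n : ℕ} (h v : Fin (k + 3) → ℕ → ℕ) : Sym2 (Fin (k + 3) × Fin n) → ℕ :=
  Sym2.lift ⟨fun p q =>
    if p.2 = q.2 then
      (if q.1 = p.1 + 1 then h p.1 p.2 else 0) + (if p.1 = q.1 + 1 then h q.1 q.2 else 0)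
    else if p.1 = q.1 then v p.1 (min p.2 q.2) else 0, by
    rintro ⟨a, b⟩ ⟨a', b'⟩
    by_cases hb : b = b'
    · subst hb
      simp [add_comm]
    · by_cases ha : a = a'
      · subst ha
        simp [hb, Ne.symm hb, min_comm]
      · simp [ha, hb, Ne.symm ha, Ne.symm hb]⟩

section gridEdgeColor

variable {k n : ℕ} (h v : Fin (k + 3) → ℕ → ℕ) (i : Fin (k + 3))

lemma gridEdgeColor_right (j : Fin n) : gridEdgeColor h v s((i, j), (i + 1, j)) = h i j := by
  have : i ≠ i + 1 + 1 := by
    have := Fin.sub_one_ne_add_one (i + 1)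
    rwa [add_sub_cancel_right] at this
  simp [gridEdgeColor, this]

lemma gridEdgeColor_left (j : Fin n) : gridEdgeColor h v s((i, j), (i - 1, j)) = h (i - 1) j := by
  have := gridEdgeColor_right h v (i - 1) j
  rwa [sub_add_cancel, Sym2.eq_swap] at this

lemma gridEdgeColor_vertical (j j' : Fin n) :
    gridEdgeColor h v s((i, j), (i, j')) = if j.val = j' then 0 else v i (min j j') := by
  by_cases hj : j = j'
  · simp [gridEdgeColor, hj]
  · simp [gridEdgeColor, hj, Fin.val_ne_of_ne hj]

lemma totalSum_gridEdgeColor (c : Fin (k + 3) → ℕ → ℕ) (j : Fin n) :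
    totalSum ((cycleGraph (k + 3)).boxProd (pathGraph n)) (fun p => c p.1 p.2)
      (gridEdgeColor h v) (i, j) = gridSum n c h v i j := by
  classical
  have key := sum_cycle_boxProd_path (fun w => gridEdgeColor h v s((i, j), w)) i j
    (fun b => if j.val = b then 0 else v i (min j b))
    (fun b => (gridEdgeColor_vertical h v i j b).symm)
  rw [gridEdgeColor_right, gridEdgeColor_left] at key
  have hsucc : (if j.val = j.val + 1 then 0 else v i (min j.val (j.val + 1))) = v i j := by simp
  have hpred (hj : 0 < j.val) :
      (if j.val = j.val - 1 then 0 else v i (min j.val (j.val - 1))) = v i (j.val - 1) := by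
    rw [if_neg (by omega), min_eq_right (by omega)]
  rw [hsucc] at key
  rw [totalSum, gridSum]
  congr 1
  trans
  swap
  · refine key.trans ?_
    congr 1
    by_cases hj : 0 < j.val
    · rw [if_pos hj, if_pos hj]
      exact hpred hj
    · rw [if_neg hj, if_neg hj]
  · exact sum_congr (by ext; simp) fun _ _ => rfl

end gridEdgeColor

/-- The four kinds of neighbors in `C_m □ P_n`. -/
lemma boxProd_cycle_path_adj_cases {k n : ℕ} {i : Fin (k + 3)} {j : Fin n}
    {w : Fin (k + 3) × Fin n}
    (h : ((cycleGraph (k + 3)).boxProd (pathGraph n)).Adj (i, j) w) :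
    w = (i + 1, j) ∨ w = (i - 1, j) ∨ (∃ b : Fin n, w = (i, b) ∧ b.val = j + 1) ∨
      ∃ b : Fin n, w = (i, b) ∧ j.val = b + 1 := by
  obtain ⟨a, b⟩ := w
  rw [boxProd_adj] at h
  rcases h with ⟨h, rfl : j = b⟩ | ⟨h, rfl : i = a⟩
  · rcases cycleGraph_adj_iff_succ.1 h with h | h <;> simp_all
  · rcases pathGraph_adj.1 h with h | h
    · exact Or.inr (Or.inr (Or.inl ⟨b, rfl, h.symm⟩))
    · exact Or.inr (Or.inr (Or.inr ⟨b, rfl, h.symm⟩))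

theorem IsGridColoring.isNSDColoring {k n K : ℕ} {c h v : Fin (k + 3) → ℕ → ℕ}
    (H : IsGridColoring n K c h v) :
    IsNSDColoring ((cycleGraph (k + 3)).boxProd (pathGraph n)) K
      (fun p => c p.1 p.2) (gridEdgeColor h v) := by
  have up (i : Fin (k + 3)) (j b : Fin n) (hb : b.val = j + 1) :
      gridEdgeColor h v s((i, j), (i, b)) = v i j := by
    rw [gridEdgeColor_vertical, if_neg (by omega), min_eq_left (by omega)]
  have down (i : Fin (k + 3)) (j b : Fin n) (hb : j.val = b + 1) :
      gridEdgeColor h v s((i, j), (i, b)) = v i b := by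
    rw [gridEdgeColor_vertical, if_neg (by omega), min_eq_right (by omega)]
  refine ⟨⟨fun ⟨i, j⟩ => H.c_mem i j j.2, ?_, ?_, ?_, ?_⟩, ?_⟩
  · rintro ⟨i, j⟩ w hw
    have hj := j.isLt
    rcases boxProd_cycle_path_adj_cases hw with rfl | rfl | ⟨b, rfl, hb⟩ | ⟨b, rfl, hb⟩
    · rw [gridEdgeColor_right]; exact H.h_mem i j hj
    · rw [gridEdgeColor_left]; exact H.h_mem _ j hj
    · rw [up i j b hb]; exact H.v_mem i j (by omega)
    · rw [down i j b hb]; exact H.v_mem i b (by omega)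
  · rintro ⟨i, j⟩ w hw
    have hj := j.isLt
    rcases boxProd_cycle_path_adj_cases hw with rfl | rfl | ⟨b, rfl, hb⟩ | ⟨b, rfl, hb⟩
    · exact H.c_ne_right i j hj
    · have := H.c_ne_right (i - 1) j hj
      rw [sub_add_cancel] at this
      exact this.symm
    · have := H.c_ne_up i j (by omega)
      rwa [← hb] at this
    · have := H.c_ne_up i b (by omega)
      rw [← hb] at this
      exact this.symm
  · rintro ⟨i, j⟩ w w' hw hw' hne
    have hj := j.isLt
    have hv (b : Fin n) (hb : b.val = j + 1) := H.v_ne_h i j (by omega)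
    have hv' (b : Fin n) (hb : j.val = b + 1) : v i b ≠ h i j ∧ v i b ≠ h (i - 1) j := by
      rw [hb]
      exact H.v_ne_h_up i b (by omega)
    have hh := H.h_ne_h i j hj
    have hvv (b b' : Fin n) (hb : b.val = j + 1) (hb' : j.val = b' + 1) : v i b' ≠ v i j := by
      rw [hb']
      exact H.v_ne_v i b' (by omega)
    rcases boxProd_cycle_path_adj_cases hw with rfl | rfl | ⟨b, rfl, hb⟩ | ⟨b, rfl, hb⟩ <;>
    rcases boxProd_cycle_path_adj_cases hw' with rfl | rfl | ⟨b', rfl, hb'⟩ | ⟨b', rfl, hb'⟩ <;>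
    clear hw hw'
    all_goals
      try rw [gridEdgeColor_right]
      try rw [gridEdgeColor_left]
      try rw [up i j b hb]
      try rw [down i j b hb]
      try rw [up i j b' hb']
      try rw [down i j b' hb']
      clear up down H
      first
        | exact absurd rfl hne
        | exact absurd (congrArg (Prod.mk i) (Fin.ext (by omega))) hne
        | grind
  · rintro ⟨i, j⟩ w hw
    have hj := j.isLt
    rcases boxProd_cycle_path_adj_cases hw with rfl | rfl | ⟨b, rfl, hb⟩ | ⟨b, rfl, hb⟩
    · rw [gridEdgeColor_right]; exact H.h_ne_c i j hj
    · rw [gridEdgeColor_left]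
      have := H.h_ne_c (i - 1) j hj
      rw [sub_add_cancel] at this
      exact this.symm
    · rw [up i j b hb]
      have := H.v_ne_c i j (by omega)
      rwa [← hb] at this
    · rw [down i j b hb]
      have := H.v_ne_c i b (by omega)
      rw [← hb] at this
      exact this.symm
  · rintro ⟨i, j⟩ w hw
    have hj := j.isLt
    rcases boxProd_cycle_path_adj_cases hw with rfl | rfl | ⟨b, rfl, hb⟩ | ⟨b, rfl, hb⟩ <;>
    rw [totalSum_gridEdgeColor, totalSum_gridEdgeColor]
    · exact H.sum_ne_right i j hj
    · have := H.sum_ne_right (i - 1) j hj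
      rw [sub_add_cancel] at this
      exact this.symm
    · have := H.sum_ne_up i j (by omega)
      rwa [← hb] at this
    · have := H.sum_ne_up i b (by omega)
      rw [← hb] at this
      exact this.symm

namespace Fin

variable {k : ℕ} (i : Fin (k + 3)) (j : ℕ)

lemma add_succ_nsmul : i + (j + 1) • (1 : Fin (k + 3)) = i + j • 1 + 1 := by
  rw [succ_nsmul]
  exact (add_assoc _ _ _).symm

lemma add_one_add_nsmul : i + 1 + j • (1 : Fin (k + 3)) = i + j • 1 + 1 :=
  add_right_comm _ _ _

lemma sub_one_add_nsmul : i - 1 + j • (1 : Fin (k + 3)) = i + j • 1 - 1 :=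
  sub_add_eq_add_sub _ _ _

end Fin

/-- For `m ≥ 4` the cycle `C_m` has a total 4-coloring, with vertex colors `C` and edge colors `H`,
such that the colors `M` missing at adjacent vertices are distinct. -/
lemma exists_cycle_total_coloring {k : ℕ} (hk : 0 < k) : ∃ C H M : Fin (k + 3) → ℕ,
    (∀ x, C x ∈ Icc 1 4 ∧ H x ∈ Icc 1 4 ∧ M x ∈ Icc 1 4) ∧
    ∀ x, C x ≠ C (x + 1) ∧ M x ≠ M (x + 1) ∧ H x ≠ H (x + 1) ∧ H x ≠ C x ∧ H x ≠ C (x + 1) ∧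
      C (x + 1) + H (x + 1) + H x + M (x + 1) = 10 := by
  have hsucc (x : Fin (k + 3)) : (x + 1).val = if x.val + 1 = k + 3 then 0 else x.val + 1 := by
    rw [Fin.val_add_one]
    simp [Fin.ext_iff]
  rcases Nat.even_or_odd' k with ⟨l, hl | hl⟩
  · refine ⟨fun x => if x.val = 1 ∨ x.val = 3 then 1 else if x.val = 2 then 2 else
        if x.val = 0 then 3 else 4 - x.val % 2,
      fun x => if x.val = 0 then 2 else if x.val = 1 then 4 else if x.val = 2 then 3 else
        1 + x.val % 2,
      fun x => if x.val = 0 then 4 else if x.val = 1 then 3 else if x.val = 2 then 1 else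
        3 + x.val % 2, ?_, ?_⟩
    · intro x
      simp only [mem_Icc]
      split_ifs <;> omega
    · intro x
      have := hsucc x
      have hx := x.isLt
      dsimp only
      generalize (x + 1).val = y at *
      generalize x.val = x at *
      split_ifs at this
      · simp only [this]; grind
      · subst this
        grind
  · refine ⟨fun x => 3 + x.val % 2, fun x => 2 - x.val % 2, fun x => 4 - x.val % 2, ?_, ?_⟩
    · intro x
      simp only [mem_Icc]
      omega
    · intro x
      have := hsucc x
      dsimp only
      split_ifs at this <;> omega

lemma exists_isGridColoring_of_pos {k : ℕ} (hk : 0 < k) (n : ℕ) :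
    ∃ c h v : Fin (k + 3) → ℕ → ℕ, IsGridColoring n (if n = 2 then 5 else 6) c h v := by
  obtain ⟨C, H, M, hmem, hne⟩ := exists_cycle_total_coloring hk
  simp only [mem_Icc] at hmem
  have hne' (x : Fin (k + 3)) := hne (x - 1)
  simp only [sub_add_cancel] at hne'
  have hsum (x : Fin (k + 3)) := (hne' x).2.2.2.2.2
  have hM (x : Fin (k + 3)) := (hne x).2.1
  refine ⟨fun i j => C (i + j • 1), fun i j => H (i + j • 1), fun _ j => 5 + j % 2, ?_⟩
  constructor
  case sum_ne_right | sum_ne_up =>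
    intro i j hj
    simp only [gridSum, Fin.add_one_add_nsmul, Fin.add_succ_nsmul, Fin.sub_one_add_nsmul,
      add_sub_cancel_right, sub_add_cancel]
    generalize i + j • 1 = x
    have h1 := (hmem x).2.2
    have h2 := (hmem (x + 1)).2.2
    have h3 := hsum x
    have h4 := hsum (x + 1)
    have h5 := hM x
    rw [add_sub_cancel_right] at h4
    clear hmem hne hne' hsum hM
    split_ifs <;> omega
  all_goals
    intro i j hj
    simp only [mem_Icc, Fin.add_one_add_nsmul, Fin.add_succ_nsmul, Fin.sub_one_add_nsmul,
      sub_add_cancel, ne_eq]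
    generalize i + j • 1 = x
    have h1 := hmem x
    have h2 := hmem (x + 1)
    have h3 := hmem (x - 1)
    have h4 := hne x
    have h5 := hne' x
    try split_ifs
    all_goals omega

/-- The rotationally symmetric coloring of `C_3 □ P_n`. -/
lemma exists_isGridColoring_three (n : ℕ) (hn : 3 ≤ n) :
    ∃ c h v : Fin (0 + 3) → ℕ → ℕ, IsGridColoring n 6 c h v := by
  refine ⟨fun i j => (i + j • 1 + 1).val + 1, fun i j => (i + j • 1).val + 1,
    fun i j => (i + j • 1).val + 4, ?_⟩
  constructor
  all_goals
    intro i j hj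
    try simp only [gridSum]
    rcases j with _ | j
    all_goals
      simp only [mem_Icc, Fin.add_one_add_nsmul, Fin.add_succ_nsmul,
        Fin.sub_one_add_nsmul, add_tsub_cancel_right, add_sub_cancel_right]
      generalize i + (_ : ℕ) • (1 : Fin (0 + 3)) = x
      try split_ifs
      all_goals first | omega | (revert x; decide)

lemma exists_isGridColoring_three_two :
    ∃ c h v : Fin (0 + 3) → ℕ → ℕ, IsGridColoring 2 5 c h v := by
  refine ⟨fun i j => if j = 0 then ![5, 3, 4] i else ![4, 5, 1] i, fun i _ => ![1, 2, 3] i,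
    fun i _ => ![2, 4, 5] i, ?_⟩
  constructor
  all_goals
    intro i j hj
    obtain rfl | rfl : j = 0 ∨ j = 1 := by omega
    all_goals first | omega | (revert i; decide)

theorem stmt_3 (m n : ℕ) (hm : 3 ≤ m) (hn : 2 ≤ n) :
    (n = 2 → maxDeg ((cycleGraph m).boxProd (pathGraph n)) = 3) ∧
    (3 ≤ n → maxDeg ((cycleGraph m).boxProd (pathGraph n)) = 4) ∧
    tndi ((cycleGraph m).boxProd (pathGraph n)) =
      maxDeg ((cycleGraph m).boxProd (pathGraph n)) + 2 := by
  obtain ⟨k, rfl⟩ : ∃ k, m = k + 3 := ⟨m - 3, by omega⟩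
  have hmax := maxDeg_cycle_boxProd_path (k := k) hn
  refine ⟨fun h => by rw [hmax, if_pos h], fun h => by rw [hmax, if_neg (by omega)], ?_⟩
  have hex : ∃ c h v : Fin (k + 3) → ℕ → ℕ, IsGridColoring n (if n = 2 then 5 else 6) c h v := by
    rcases k with _ | k
    · split_ifs with h
      · subst h
        exact exists_isGridColoring_three_two
      · exact exists_isGridColoring_three n (by omega)
    · exact exists_isGridColoring_of_pos k.succ_pos n
  obtain ⟨c, h, v, H⟩ := hex
  have hmem : maxDeg ((cycleGraph (k + 3)).boxProd (pathGraph n)) + 2 ∈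
      {K | ∃ cv ce, IsNSDColoring ((cycleGraph (k + 3)).boxProd (pathGraph n)) K cv ce} := by
    have hK : (if n = 2 then 5 else 6) =
        maxDeg ((cycleGraph (k + 3)).boxProd (pathGraph n)) + 2 := by
      rw [hmax]
      split_ifs <;> rfl
    exact ⟨_, _, hK ▸ H.isNSDColoring⟩
  refine le_antisymm (Nat.sInf_le hmem) (le_csInf ⟨_, hmem⟩ ?_)
  rintro K ⟨cv, ce, hK⟩
  exact le_of_isNSDColoring hn hK
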